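/- Let α ∈ ℝ and μ, ρ, λ ∈ ℂ satisfy Re(μ - ρ) > Re λ + 1 > 0. Then the fractional-type integral relation P_{λ+ρ+1}^{-μ}(tanh α) · (cosh α)^{λ+ρ+1} = (Γ(μ-ρ) / (Γ(1+λ) Γ(μ-λ-ρ-1))) · ∫_α^∞ P_ρ^{-μ}(tanh s) · (cosh s)^{ρ+1} · (sinh s - sinh α)^λ ds holds, with principal complex powers of positive reals. -/

import Mathlib

noncomputable def pochC (a : ℂ) (n : ℕ) : ℂ := (ascPochhammer ℂ n).eval a

/-- Ferrers function of the first kind `P_ν^μ(x)`. -/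
noncomputable def ferrersP (ν μ : ℂ) (x : ℝ) : ℂ :=
  (((1 + x) / (1 - x) : ℝ) : ℂ) ^ (μ / 2) *
    ∑' n : ℕ, pochC (-ν) n * pochC (ν + 1) n /
        (Complex.Gamma ((n : ℂ) + 1 - μ) * (n.factorial : ℂ)) *
      (((1 - x) / 2 : ℝ) : ℂ) ^ n

open Complex Filter Topology MeasureTheory Set

lemma pochC_zero (a : ℂ) : pochC a 0 = 1 := by simp [pochC]

lemma pochC_succ (a : ℂ) (n : ℕ) : pochC a (n + 1) = pochC a n * (a + n) :=
  ascPochhammer_succ_eval n a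

lemma pochC_succ_left (a : ℂ) (n : ℕ) : pochC a (n + 1) = a * pochC (a + 1) n := by
  simp [pochC, ascPochhammer_succ_left]

lemma pochC_mul (a : ℂ) (m n : ℕ) : pochC a m * pochC (a + m) n = pochC a (m + n) := by
  simp [pochC, ← ascPochhammer_mul]

lemma pochC_two_mul (c : ℂ) (k : ℕ) :
    pochC c (2 * k) = 4 ^ k * (pochC (c / 2) k * pochC ((c + 1) / 2) k) := by
  induction k with
  | zero => simp [pochC_zero]
  | succ k ih =>
    rw [show 2 * (k + 1) = 2 * k + 1 + 1 by ring, pochC_succ, pochC_succ, ih, pochC_succ,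
      pochC_succ]
    push_cast
    ring

lemma pochC_reflect (a : ℂ) (n : ℕ) : pochC (1 - a - n) n = (-1) ^ n * pochC a n := by
  induction n with
  | zero => simp [pochC_zero]
  | succ n ih =>
    rw [pochC_succ_left, show 1 - a - ((n + 1 : ℕ) : ℂ) + 1 = 1 - a - n by push_cast; ring, ih,
      pochC_succ]
    push_cast
    ring

lemma norm_pochC_le {a : ℂ} {r : ℝ} (h : ‖a‖ ≤ r) (n : ℕ) :
    ‖pochC a n‖ ≤ (ascPochhammer ℝ n).eval r := by
  induction n with
  | zero => simp [pochC_zero]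
  | succ n ih =>
    rw [pochC_succ, ascPochhammer_succ_eval, norm_mul]
    have h' : ‖a + n‖ ≤ r + n := (norm_add_le _ _).trans (by simpa using h)
    exact mul_le_mul ih h' (norm_nonneg _) ((norm_nonneg _).trans ih)

/-- A Chu–Vandermonde summation, with reciprocal Gamma functions in place of Pochhammer symbols. -/
lemma sum_choose_mul_pochC_mul_inv_Gamma (N : ℕ) (b g : ℂ) :
    ∑ k ∈ Finset.range (N + 1), (N.choose k : ℂ) * ((-1) ^ k * pochC b k * (Gamma (g + k))⁻¹) =
      pochC (g - b) N * (Gamma (g + N))⁻¹ := by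
  induction N generalizing b g with
  | zero => simp [pochC_zero]
  | succ N ih =>
    have h := Finset.sum_choose_succ_mul
      (fun i _ => (-1) ^ i * pochC b i * (Gamma (g + i))⁻¹) N
    rw [h, ih]
    have h2 : ∀ i ∈ Finset.range (N + 1),
        (N.choose i : ℂ) * ((-1) ^ (i + 1) * pochC b (i + 1) * (Gamma (g + (i + 1 : ℕ)))⁻¹) =
        -b * ((N.choose i : ℂ) * ((-1) ^ i * pochC (b + 1) i * (Gamma (g + 1 + i))⁻¹)) := by
      intro i _
      rw [pochC_succ_left, show g + ((i + 1 : ℕ) : ℂ) = g + 1 + i by push_cast; ring]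
      ring
    rw [Finset.sum_congr rfl h2, ← Finset.mul_sum, ih, pochC_succ,
      one_div_Gamma_eq_self_mul_one_div_Gamma_add_one (g + N),
      show g + 1 - (b + 1) = g - b by ring, show g + 1 + (N : ℂ) = g + N + 1 by ring,
      show g + ((N + 1 : ℕ) : ℂ) = g + N + 1 by push_cast; ring]
    ring

lemma choose_eq_pochC_div (a : ℂ) (n : ℕ) :
    Ring.choose (a + n - 1) n = pochC a n / (n.factorial : ℂ) := by
  rw [← Ring.multichoose_eq, eq_div_iff (by exact_mod_cast n.factorial_ne_zero), mul_comm,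
    ← nsmul_eq_mul, Ring.factorial_nsmul_multichoose_eq_ascPochhammer,
    Polynomial.ascPochhammer_smeval_eq_eval, pochC]

lemma choose_eq_ascPochhammer_div (a : ℝ) (n : ℕ) :
    Ring.choose (a + n - 1) n = (ascPochhammer ℝ n).eval a / (n.factorial : ℝ) := by
  rw [← Ring.multichoose_eq, eq_div_iff (by exact_mod_cast n.factorial_ne_zero), mul_comm,
    ← nsmul_eq_mul, Ring.factorial_nsmul_multichoose_eq_ascPochhammer,
    Polynomial.ascPochhammer_smeval_eq_eval]

lemma hasSum_pochC_binomial (a : ℂ) {x : ℂ} (hx : ‖x‖ < 1) :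
    HasSum (fun n : ℕ => pochC a n / (n.factorial : ℂ) * x ^ n) ((1 - x) ^ (-a)) := by
  have h := (one_div_one_sub_cpow_hasFPowerSeriesOnBall_zero a).hasSum (y := x)
    (by simpa [← ofReal_norm] using hx)
  rw [cpow_neg, ← one_div]
  simpa only [FormalMultilinearSeries.ofScalars_apply_eq, choose_eq_pochC_div, zero_add,
    smul_eq_mul] using h

lemma hasSum_ascPochhammer_binomial (a : ℝ) {x : ℝ} (hx : |x| < 1) :
    HasSum (fun n : ℕ => (ascPochhammer ℝ n).eval a / (n.factorial : ℝ) * x ^ n)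
      (((1 - x) ^ a)⁻¹) := by
  have h := (Real.one_div_one_sub_rpow_hasFPowerSeriesOnBall_zero a).hasSum (y := x)
    (by simpa [← ofReal_norm] using hx)
  rw [← one_div]
  simpa only [FormalMultilinearSeries.ofScalars_apply_eq, choose_eq_ascPochhammer_div, zero_add,
    smul_eq_mul] using h

lemma hasFPowerSeriesOnBall_regularizedGaussHGFun (a b g : ℂ) :
    HasFPowerSeriesOnBall (regularizedGaussHGFun a b g) (regularizedGaussHGFunSeries a b g) 0 1 :=
  ((regularizedGaussHGFunSeries a b g).hasFPowerSeriesOnBall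
    (lt_of_lt_of_le one_pos (radius_regularizedGaussHGFunSeries_ge_one a b g))).mono one_pos
    (radius_regularizedGaussHGFunSeries_ge_one a b g)

lemma coeff_regularizedGaussHGFunSeries_eq_pochC (a b g : ℂ) (n : ℕ) :
    (regularizedGaussHGFunSeries a b g).coeff n =
      pochC a n * pochC b n / (n.factorial * Gamma (g + n)) :=
  coeff_regularizedGaussHGFunSeries

lemma hasSum_regularizedGaussHGFun (a b g : ℂ) {z : ℂ} (hz : ‖z‖ < 1) :
    HasSum (fun n => (regularizedGaussHGFunSeries a b g).coeff n * z ^ n)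
      (regularizedGaussHGFun a b g z) := by
  have h := (hasFPowerSeriesOnBall_regularizedGaussHGFun a b g).hasSum (y := z)
    (by simpa [← ofReal_norm] using hz)
  simpa [mul_comm] using h

lemma summable_norm_coeff_regularizedGaussHGFunSeries (a b g : ℂ) {r : ℝ} (hr : 0 ≤ r)
    (hr1 : r < 1) :
    Summable fun n => ‖(regularizedGaussHGFunSeries a b g).coeff n‖ * r ^ n := by
  lift r to NNReal using hr
  have h := (regularizedGaussHGFunSeries a b g).summable_norm_mul_pow (r := r)
    (lt_of_lt_of_le (by exact_mod_cast hr1) (radius_regularizedGaussHGFunSeries_ge_one a b g))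
  simpa [FormalMultilinearSeries.norm_apply_eq_norm_coef] using h

lemma hasSum_pow_mul_cpow_rearrange (A : ℕ → ℂ) (d ε y : ℂ) (m : ℕ) (hε : ‖ε‖ = 1)
    (hy : ‖y‖ < 1)
    (hA : Summable fun k => ‖A k‖ * (‖y‖ / (1 - ‖y‖) ^ m) ^ k) :
    HasSum (fun n => (∑ k ∈ Finset.range (n + 1),
        A k * (pochC (d + m * k) (n - k) / ((n - k).factorial : ℂ) * ε ^ (n - k))) * y ^ n)
      (∑' k, A k * y ^ k * (1 - ε * y) ^ (-(d + m * k))) := by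
  have hεy : ‖ε * y‖ < 1 := by rwa [norm_mul, hε, one_mul]
  have hpos : 0 < 1 - ‖y‖ := by linarith
  have hy' : |‖y‖| < 1 := by simpa using hy
  let f : ℕ × ℕ → ℂ := fun p =>
    A p.1 * y ^ p.1 * (pochC (d + m * p.1) p.2 / (p.2.factorial : ℂ) * (ε * y) ^ p.2)
  let F : ℕ × ℕ → ℝ := fun p => ‖A p.1‖ * ‖y‖ ^ p.1 *
    ((ascPochhammer ℝ p.2).eval (‖d‖ + m * p.1) / (p.2.factorial : ℝ) * ‖y‖ ^ p.2)
  have hasc : ∀ k j : ℕ, 0 ≤ (ascPochhammer ℝ j).eval (‖d‖ + m * (k : ℝ)) := fun k j =>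
    (norm_nonneg _).trans (norm_pochC_le (a := d + m * k)
      ((norm_add_le _ _).trans (by simp)) j)
  have hfF : ∀ p, ‖f p‖ ≤ F p := by
    intro p
    simp only [f, F, norm_mul, norm_div, norm_pow, hε, one_mul, Complex.norm_natCast]
    gcongr
    exact norm_pochC_le ((norm_add_le _ _).trans (by simp)) _
  have hFsum : Summable F := by
    rw [summable_prod_of_nonneg]
    · refine ⟨fun k => ?_, ?_⟩
      · exact ((hasSum_ascPochhammer_binomial (‖d‖ + m * k) hy').summable).mul_left
          (‖A k‖ * ‖y‖ ^ k)
      · have : ∀ k : ℕ, ∑' j, F (k, j) =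
            (((1 - ‖y‖) ^ ‖d‖)⁻¹) * (‖A k‖ * (‖y‖ / (1 - ‖y‖) ^ m) ^ k) := by
          intro k
          simp only [F]
          rw [tsum_mul_left, (hasSum_ascPochhammer_binomial _ hy').tsum_eq,
            Real.rpow_add hpos, ← Nat.cast_mul, Real.rpow_natCast, pow_mul, div_pow]
          field_simp
        simp only [this]
        exact hA.mul_left _
    · intro p
      exact (norm_nonneg _).trans (hfF p)
  have hf : Summable f := Summable.of_norm_bounded hFsum hfF
  have h1 : ∑' p, f p = ∑' k, A k * y ^ k * (1 - ε * y) ^ (-(d + m * k)) := by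
    rw [hf.tsum_prod]
    refine tsum_congr fun k => ?_
    simp only [f]
    rw [tsum_mul_left, (hasSum_pochC_binomial _ hεy).tsum_eq]
  rw [← h1]
  have h2 := ((Finset.HasAntidiagonal.sigmaAntidiagonalEquivProd (A := ℕ)).hasSum_iff.mpr
    hf.hasSum).sigma fun n => hasSum_fintype _
  convert h2 using 2 with n
  rw [Finset.sum_mul, ← Finset.Nat.sum_antidiagonal_eq_sum_range_succ
    (fun k j => A k * (pochC (d + m * k) j / (j.factorial : ℂ) * ε ^ j) * y ^ n),
    ← Finset.sum_coe_sort]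
  refine Finset.sum_congr rfl fun p _ => ?_
  have hp : p.1.1 + p.1.2 = n := Finset.HasAntidiagonal.mem_antidiagonal.mp p.2
  simp only [f, Function.comp, Finset.HasAntidiagonal.sigmaAntidiagonalEquivProd_apply,
    mul_pow, ← hp, pow_add]
  ring

lemma choose_eq_factorial_div {n k : ℕ} (h : k ≤ n) :
    (n.choose k : ℂ) = n.factorial / (k.factorial * (n - k).factorial) := by
  rw [Nat.cast_choose ℂ h]

lemma sum_pfaff_coeff (a b g : ℂ) (n : ℕ) :
    ∑ k ∈ Finset.range (n + 1), (regularizedGaussHGFunSeries a b g).coeff k *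
        (pochC (a + (1 : ℕ) * k) (n - k) / ((n - k).factorial : ℂ) * (-1) ^ (n - k)) =
      (-1) ^ n * (regularizedGaussHGFunSeries a (g - b) g).coeff n := by
  have key := sum_choose_mul_pochC_mul_inv_Gamma n b g
  rw [coeff_regularizedGaussHGFunSeries_eq_pochC]
  trans (-1) ^ n * pochC a n / n.factorial * (pochC (g - b) n * (Gamma (g + n))⁻¹)
  · rw [← key, Finset.mul_sum]
    refine Finset.sum_congr rfl fun k hk => ?_
    have hk' : k ≤ n := by simpa [Nat.lt_succ_iff] using hk
    have hp := pochC_mul a k (n - k)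
    rw [Nat.add_sub_cancel' hk'] at hp
    have hs : (-1 : ℂ) ^ n * (-1) ^ k = (-1) ^ (n - k) := by
      conv_lhs => rw [← Nat.add_sub_cancel' hk', pow_add, mul_right_comm, ← mul_pow]
      simp
    have hn : (n.factorial : ℂ) ≠ 0 := by exact_mod_cast n.factorial_ne_zero
    rw [coeff_regularizedGaussHGFunSeries_eq_pochC, choose_eq_factorial_div hk', ← hp, ← hs]
    push_cast
    field_simp
  · field_simp

lemma sum_quadratic_coeff (c g : ℂ) (n : ℕ) :
    ∑ k ∈ Finset.range (n + 1),
        ((-4) ^ k * (regularizedGaussHGFunSeries (c / 2) ((c + 1) / 2) g).coeff k) *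
        (pochC (c + (2 : ℕ) * k) (n - k) / ((n - k).factorial : ℂ) * 1 ^ (n - k)) =
      (-1) ^ n * (regularizedGaussHGFunSeries c (1 + c - g) g).coeff n := by
  have key := sum_choose_mul_pochC_mul_inv_Gamma n (c + n) g
  rw [coeff_regularizedGaussHGFunSeries_eq_pochC]
  rw [show g - (c + n) = 1 - (1 + c - g) - n by ring, pochC_reflect] at key
  trans pochC c n / n.factorial * ((-1) ^ n * pochC (1 + c - g) n * (Gamma (g + n))⁻¹)
  · rw [← key, Finset.mul_sum]
    refine Finset.sum_congr rfl fun k hk => ?_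
    have hk' : k ≤ n := by simpa [Nat.lt_succ_iff] using hk
    have hp := pochC_mul c (2 * k) (n - k)
    rw [show 2 * k + (n - k) = n + k by omega, ← pochC_mul c n k, pochC_two_mul] at hp
    have hn : (n.factorial : ℂ) ≠ 0 := by exact_mod_cast n.factorial_ne_zero
    rw [coeff_regularizedGaussHGFunSeries_eq_pochC, choose_eq_factorial_div hk',
      show (-4 : ℂ) ^ k = (-1) ^ k * 4 ^ k by rw [← mul_pow]; norm_num]
    push_cast at hp ⊢
    trans (-1) ^ k * (pochC c n * pochC (c + n) k) / (k.factorial * Gamma (g + k)) /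
      ((n - k).factorial : ℂ)
    · rw [← hp]
      simp only [one_pow, mul_one]
      field_simp
    · field_simp
  · field_simp

lemma regularizedGaussHGFun_pfaff (a b g : ℂ) {y : ℂ} (hy : ‖y‖ < 1 / 2) :
    (1 + y) ^ (-a) * regularizedGaussHGFun a b g (y / (1 + y)) =
      regularizedGaussHGFun a (g - b) g (-y) := by
  have hpos : 0 < 1 - ‖y‖ := by linarith
  have hle : 1 - ‖y‖ ≤ ‖1 + y‖ := by
    have := norm_sub_norm_le (1 : ℂ) (-y)
    simpa using this
  have h1y : 1 + y ≠ 0 := norm_pos_iff.mp (hpos.trans_le hle)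
  have hlt : ‖y‖ / (1 - ‖y‖) < 1 := by rw [div_lt_one hpos]; linarith
  have hz : ‖y / (1 + y)‖ < 1 := by
    rw [norm_div]
    exact lt_of_le_of_lt (by gcongr) hlt
  have H := hasSum_pow_mul_cpow_rearrange (regularizedGaussHGFunSeries a b g).coeff a (-1) y 1
    (by simp) (by linarith) (by
      simpa using summable_norm_coeff_regularizedGaussHGFunSeries a b g (by positivity) hlt)
  simp only [sum_pfaff_coeff] at H
  have H2 := hasSum_regularizedGaussHGFun a (g - b) g (z := -y) (by simp; linarith)
  have H3 := (hasSum_regularizedGaussHGFun a b g hz).mul_left ((1 + y) ^ (-a))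
  refine (H3.tsum_eq.symm.trans ?_).trans (H.unique ?_)
  · refine tsum_congr fun k => ?_
    rw [neg_mul, one_mul, sub_neg_eq_add, neg_add, cpow_add _ _ h1y, Nat.cast_one, one_mul,
      cpow_neg _ (k : ℂ), cpow_natCast, div_pow]
    ring
  · convert H2 using 2 with n
    rw [neg_pow y]
    ring

lemma regularizedGaussHGFun_quadratic (c g : ℂ) {y : ℂ} (hy : ‖y‖ < 1 / 10) :
    (1 - y) ^ (-c) * regularizedGaussHGFun (c / 2) ((c + 1) / 2) g (-4 * y / (1 - y) ^ 2) =
      regularizedGaussHGFun c (1 + c - g) g (-y) := by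
  have hpos : 0 < 1 - ‖y‖ := by linarith
  have hle : 1 - ‖y‖ ≤ ‖1 - y‖ := by
    simpa using norm_sub_norm_le (1 : ℂ) y
  have h1y : 1 - y ≠ 0 := norm_pos_iff.mp (hpos.trans_le hle)
  have hlt : 4 * ‖y‖ / (1 - ‖y‖) ^ 2 < 1 := by
    rw [div_lt_one (by positivity)]
    nlinarith [norm_nonneg y]
  have hz : ‖-4 * y / (1 - y) ^ 2‖ < 1 := by
    rw [norm_div, norm_mul, norm_pow]
    refine lt_of_le_of_lt ?_ hlt
    simp only [norm_neg, Complex.norm_ofNat]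
    gcongr
  have H := hasSum_pow_mul_cpow_rearrange
    (fun k => (-4) ^ k * (regularizedGaussHGFunSeries (c / 2) ((c + 1) / 2) g).coeff k) c 1 y 2
    (by simp) (by linarith) (by
      convert summable_norm_coeff_regularizedGaussHGFunSeries (c / 2) ((c + 1) / 2) g
        (by positivity) hlt using 2 with k
      rw [norm_mul, norm_pow, mul_div_assoc, mul_pow 4]
      simp only [norm_neg, Complex.norm_ofNat]
      ring)
  simp only [sum_quadratic_coeff] at H
  have H2 := hasSum_regularizedGaussHGFun c (1 + c - g) g (z := -y) (by simp; linarith)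
  have H3 := (hasSum_regularizedGaussHGFun (c / 2) ((c + 1) / 2) g hz).mul_left ((1 - y) ^ (-c))
  refine (H3.tsum_eq.symm.trans ?_).trans (H.unique ?_)
  · refine tsum_congr fun k => ?_
    rw [one_mul, neg_add, cpow_add _ _ h1y, ← Nat.cast_mul,
      cpow_neg _ ((2 * k : ℕ) : ℂ), cpow_natCast, div_pow, mul_pow, pow_mul]
    ring
  · convert H2 using 2 with n
    rw [neg_pow y]
    ring

/-- The analytic factor of `P_ν^{-μ}(tanh s) (cosh s)^ν`, as a function of `y = exp (-2 s)`. -/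
noncomputable def ferrersAux (ν μ y : ℂ) : ℂ :=
  (1 + y) ^ ν * regularizedGaussHGFun (-ν) (ν + 1) (1 + μ) (y / (1 + y))

lemma ferrersAux_eq_quadratic (ν μ : ℂ) {y : ℂ} (hy : ‖y‖ < 1 / 10) :
    ferrersAux ν μ y = (1 - y) ^ (-(μ - ν)) *
      regularizedGaussHGFun ((μ - ν) / 2) ((μ - ν + 1) / 2) (1 + μ) (-4 * y / (1 - y) ^ 2) := by
  have h1 := regularizedGaussHGFun_pfaff (-ν) (ν + 1) (1 + μ) (y := y) (by linarith)
  rw [neg_neg] at h1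
  rw [ferrersAux, h1, regularizedGaussHGFun_quadratic _ _ hy, regularizedGaussHGFun_symm]
  congr 1 <;> ring

lemma integrableOn_beta {p q : ℂ} (hp : 0 < p.re) (hq : 0 < q.re) :
    IntegrableOn (fun u : ℝ => (u : ℂ) ^ (p - 1) * (1 - (u : ℂ)) ^ (q - 1)) (Ioo 0 1) := by
  have h := betaIntegral_convergent hp hq
  rwa [intervalIntegrable_iff_integrableOn_Ioo_of_le zero_le_one] at h

lemma setIntegral_beta {p q : ℂ} (hp : 0 < p.re) (hq : 0 < q.re) :
    ∫ u in Ioo (0 : ℝ) 1, (u : ℂ) ^ (p - 1) * (1 - (u : ℂ)) ^ (q - 1) =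
      Gamma p * Gamma q / Gamma (p + q) := by
  rw [Gamma_mul_Gamma_eq_betaIntegral hp hq, mul_div_cancel_left₀, betaIntegral,
    intervalIntegral.integral_of_le zero_le_one, integral_Ioc_eq_integral_Ioo]
  exact Gamma_ne_zero_of_re_pos (by simpa using add_pos hp hq)

lemma Gamma_add_natCast_eq_pochC {a : ℂ} (ha : 0 < a.re) (n : ℕ) :
    Gamma (a + n) = pochC a n * Gamma a := by
  induction n with
  | zero => simp [pochC_zero]
  | succ n ih =>
    have : a + n ≠ 0 := fun h => by
      have := congrArg re h
      simp at this
      have : (0:ℝ) ≤ n := n.cast_nonneg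
      linarith
    rw [Nat.cast_succ, ← add_assoc, Gamma_add_one _ this, ih, pochC_succ]
    ring

lemma integral_beta_mul_regularizedGaussHGFun {p q : ℂ} (hp : 0 < p.re) (hq : 0 < q.re) (g : ℂ)
    {X : ℂ} (hX : ‖X‖ < 1) :
    Gamma (p + q) * ∫ u in Ioo (0 : ℝ) 1, (u : ℂ) ^ (p - 1) * (1 - (u : ℂ)) ^ (q - 1) *
        regularizedGaussHGFun ((p + q) / 2) ((p + q + 1) / 2) g (X * (u : ℂ) ^ 2) =
      Gamma q * Gamma p * regularizedGaussHGFun (p / 2) ((p + 1) / 2) g X := by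
  have hpq : 0 < (p + q).re := by simpa using add_pos hp hq
  set c := (regularizedGaussHGFunSeries ((p + q) / 2) ((p + q + 1) / 2) g).coeff with hc
  let w : ℝ → ℂ := fun u => (u : ℂ) ^ (p - 1) * (1 - (u : ℂ)) ^ (q - 1)
  let F : ℕ → ℝ → ℂ := fun k u => w u * (c k * (X * (u : ℂ) ^ 2) ^ k)
  have hw : IntegrableOn w (Ioo 0 1) := integrableOn_beta hp hq
  have hpk : ∀ k : ℕ, 0 < (p + (2 * k : ℕ)).re := fun k => by
    simp only [add_re, natCast_re]
    positivity
  have hF : ∀ k, EqOn (F k) (fun u : ℝ => c k * X ^ k *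
      ((u : ℂ) ^ (p + (2 * k : ℕ) - 1) * (1 - (u : ℂ)) ^ (q - 1))) (Ioo 0 1) := by
    intro k u hu
    have hu0 : (u : ℂ) ≠ 0 := by exact_mod_cast hu.1.ne'
    simp only [F, w]
    rw [show p + (2 * k : ℕ) - 1 = p - 1 + (2 * k : ℕ) by ring, cpow_add _ _ hu0, cpow_natCast,
      pow_mul, mul_pow]
    ring
  have hFint : ∀ k, IntegrableOn (F k) (Ioo 0 1) := fun k =>
    IntegrableOn.congr_fun ((integrableOn_beta (hpk k) hq).const_mul (c k * X ^ k)) (hF k).symm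
      measurableSet_Ioo
  have hFsum : Summable fun k => ∫ u in Ioo (0 : ℝ) 1, ‖F k u‖ := by
    refine Summable.of_nonneg_of_le (fun k => integral_nonneg fun u => norm_nonneg _) (fun k => ?_)
      ((summable_norm_coeff_regularizedGaussHGFunSeries ((p + q) / 2) ((p + q + 1) / 2) g
        (norm_nonneg X) hX).mul_right (∫ u in Ioo (0 : ℝ) 1, ‖w u‖))
    rw [← integral_const_mul]
    refine setIntegral_mono_on (hFint k).norm (hw.norm.const_mul _) measurableSet_Ioo
      fun u hu => ?_
    simp only [F, norm_mul, norm_pow, ← hc]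
    have : ‖(u : ℂ)‖ ≤ 1 := by
      rw [norm_real, Real.norm_eq_abs, abs_of_pos hu.1]
      exact hu.2.le
    rw [mul_comm]
    gcongr
    exact mul_le_of_le_one_right (norm_nonneg _) (pow_le_one₀ (norm_nonneg _) this)
  have H := hasSum_integral_of_summable_integral_norm hFint hFsum
  have hint : ∀ k, ∫ u in Ioo (0 : ℝ) 1, F k u = Gamma q * Gamma p / Gamma (p + q) *
      ((regularizedGaussHGFunSeries (p / 2) ((p + 1) / 2) g).coeff k * X ^ k) := by
    intro k
    rw [setIntegral_congr_fun measurableSet_Ioo (hF k), integral_const_mul,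
      setIntegral_beta (hpk k) hq, show p + (2 * k : ℕ) + q = p + q + (2 * k : ℕ) by ring,
      Gamma_add_natCast_eq_pochC hp, Gamma_add_natCast_eq_pochC hpq, hc,
      coeff_regularizedGaussHGFunSeries_eq_pochC, coeff_regularizedGaussHGFunSeries_eq_pochC]
    have h0 : pochC (p + q) (2 * k) ≠ 0 := fun h => by
      have h' := Gamma_add_natCast_eq_pochC hpq (2 * k)
      rw [h, zero_mul] at h'
      refine Gamma_ne_zero_of_re_pos ?_ h'
      simp only [add_re, natCast_re] at hpq ⊢
      positivity
    have h1 := Gamma_ne_zero_of_re_pos hpq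
    rw [pochC_two_mul] at h0 ⊢
    rw [pochC_two_mul]
    obtain ⟨h4, h5⟩ := mul_ne_zero_iff.mp h0
    obtain ⟨h6, h7⟩ := mul_ne_zero_iff.mp h5
    field_simp
  simp only [hint] at H
  have H' := (hasSum_regularizedGaussHGFun (p / 2) ((p + 1) / 2) g hX).mul_left
    (Gamma q * Gamma p / Gamma (p + q))
  have h1 := Gamma_ne_zero_of_re_pos hpq
  rw [← mul_div_cancel_left₀ (Gamma q * Gamma p *
    regularizedGaussHGFun (p / 2) ((p + 1) / 2) g X) h1, mul_div_assoc]
  congr 1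
  rw [mul_div_right_comm, ← H.unique H']
  refine setIntegral_congr_fun measurableSet_Ioo fun u hu => ?_
  have hu1 : ‖X * (u : ℂ) ^ 2‖ < 1 := by
    rw [norm_mul, norm_pow, norm_real, Real.norm_eq_abs, abs_of_pos hu.1]
    exact lt_of_le_of_lt (mul_le_of_le_one_right (norm_nonneg _)
      (pow_le_one₀ hu.1.le hu.2.le)) hX
  simp only [F, w]
  rw [tsum_mul_left, hc, (hasSum_regularizedGaussHGFun _ _ g hu1).tsum_eq]

lemma ofReal_mul_div_cpow {a b c : ℝ} (ha : 0 < a) (hb : 0 < b) (hc : 0 < c) (z : ℂ) :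
    ((a * b / c : ℝ) : ℂ) ^ z = (a : ℂ) ^ z * (b : ℂ) ^ z * (c : ℂ) ^ (-z) := by
  rw [cpow_neg, ← inv_cpow _ _ (by rw [arg_ofReal_of_nonneg hc.le]; exact Real.pi_pos.ne),
    ← ofReal_inv, div_eq_mul_inv, ofReal_mul, ofReal_mul,
    ← mul_cpow_ofReal_nonneg ha.le hb.le, ← ofReal_mul,
    ← mul_cpow_ofReal_nonneg (by positivity) (by positivity)]

lemma integral_comp_quadratic_sub {y : ℝ} (hy : 0 < y) (hy1 : y < 1) (f : ℝ → ℂ) :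
    ∫ u in Ioo (0 : ℝ) 1, f u =
      ∫ v in Ioo (0 : ℝ) 1, ((1 - y) * (1 + y * v ^ 2) / (1 - y * v ^ 2) ^ 2) •
        f (v * (1 - y) / (1 - y * v ^ 2)) := by
  set φ : ℝ → ℝ := fun v => v * (1 - y) / (1 - y * v ^ 2) with hφ
  have hpos : ∀ v ∈ Icc (0 : ℝ) 1, 0 < 1 - y * v ^ 2 := fun v hv => by
    have : v ^ 2 ≤ 1 := pow_le_one₀ hv.1 hv.2
    nlinarith
  have hderiv : ∀ v ∈ Icc (0 : ℝ) 1,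
      HasDerivAt φ ((1 - y) * (1 + y * v ^ 2) / (1 - y * v ^ 2) ^ 2) v := fun v hv => by
    have h1 := ((hasDerivAt_id v).mul_const (1 - y)).div
      (((hasDerivAt_id v).pow 2).const_mul y |>.const_sub 1) (hpos v hv).ne'
    refine h1.congr_deriv ?_
    simp only [id, Pi.pow_apply]
    push_cast
    ring
  have hcont : ContinuousOn φ (Icc 0 1) := fun v hv =>
    (hderiv v hv).continuousAt.continuousWithinAt
  have hmono : StrictMonoOn φ (Icc 0 1) := fun v hv w hw hvw => by
    simp only [hφ]
    rw [div_lt_div_iff₀ (hpos v hv) (hpos w hw)]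
    have : 0 ≤ y * (v * w) := mul_nonneg hy.le (mul_nonneg hv.1 hw.1)
    have h2 : 0 < (w - v) * (1 + y * (v * w)) := mul_pos (by linarith) (by linarith)
    have h3 := mul_pos (sub_pos.mpr hy1) h2
    nlinarith
  have h0 : φ 0 = 0 := by simp [hφ]
  have h1 : φ 1 = 1 := by
    simp only [hφ]
    rw [one_mul, one_pow, mul_one, div_self (by linarith)]
  have himage : φ '' Ioo 0 1 = Ioo 0 1 := by
    refine Subset.antisymm ?_ ?_
    · rintro _ ⟨v, hv, rfl⟩
      have hv' := Ioo_subset_Icc_self hv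
      exact ⟨h0 ▸ hmono (by simp) hv' hv.1, h1 ▸ hmono hv' (by simp) hv.2⟩
    · have := intermediate_value_Ioo zero_le_one hcont
      rwa [h0, h1] at this
  conv_lhs => rw [← himage]
  rw [integral_image_eq_integral_abs_deriv_smul measurableSet_Ioo
    (fun v hv => (hderiv v (Ioo_subset_Icc_self hv)).hasDerivWithinAt)
    (hmono.injOn.mono Ioo_subset_Icc_self)]
  refine setIntegral_congr_fun measurableSet_Ioo fun v hv => ?_
  have := hpos v (Ioo_subset_Icc_self hv)
  have h1y : 0 < 1 - y := by linarith
  rw [abs_of_nonneg (by positivity)]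

lemma ferrersAux_eq_integral_of_lt {p q : ℂ} (hp : 0 < p.re) (hq : 0 < q.re) (μ : ℂ) {y : ℝ}
    (hy : 0 < y) (hy1 : y < 1 / 10) :
    Gamma q * Gamma p * ferrersAux (μ - p) μ y =
      Gamma (p + q) * ∫ v in Ioo (0 : ℝ) 1, (v : ℂ) ^ (p - 1) * (1 - (v : ℂ)) ^ (q - 1) *
        ((1 + y * v) ^ (q - 1) * (1 + y * v ^ 2) * ferrersAux (μ - p - q) μ (y * v ^ 2)) := by
  have h1y : 0 < 1 - y := by linarith
  have h1y' : (1 - y : ℂ) ≠ 0 := by exact_mod_cast h1y.ne'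
  have hyn : ‖(y : ℂ)‖ < 1 / 10 := by rwa [norm_real, Real.norm_eq_abs, abs_of_pos hy]
  have hX : ‖-4 * (y : ℂ) / (1 - y) ^ 2‖ < 1 := by
    have : ‖-4 * (y : ℂ) / (1 - y) ^ 2‖ = 4 * y / (1 - y) ^ 2 := by
      rw [← ofReal_one, ← ofReal_sub, norm_div, norm_mul, norm_pow, norm_real, norm_real,
        Real.norm_eq_abs, Real.norm_eq_abs, abs_of_pos hy, abs_of_pos h1y]
      simp
    rw [this, div_lt_one (by positivity)]
    nlinarith
  rw [ferrersAux_eq_quadratic _ _ hyn, sub_sub_cancel, mul_left_comm,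
    ← integral_beta_mul_regularizedGaussHGFun hp hq (1 + μ) hX,
    integral_comp_quadratic_sub hy (by linarith), mul_left_comm, ← integral_const_mul]
  congr 1
  refine setIntegral_congr_fun measurableSet_Ioo fun v hv => ?_
  have hv2 : v ^ 2 < 1 := pow_lt_one₀ hv.1.le hv.2 two_ne_zero
  have hd : 0 < 1 - y * v ^ 2 := by nlinarith
  have hd' : (1 - y * v ^ 2 : ℂ) ≠ 0 := by exact_mod_cast hd.ne'
  have hyv : ‖(y * v ^ 2 : ℂ)‖ < 1 / 10 := by
    rw [norm_mul, norm_pow, norm_real v, Real.norm_eq_abs, sq_abs]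
    nlinarith [norm_nonneg (y : ℂ), sq_nonneg v]
  have hv1 : 0 < 1 - v := by linarith [hv.2]
  have hvy : 0 < 1 + y * v := by nlinarith [mul_pos hy hv.1]
  have e1 := ofReal_mul_div_cpow hv.1 h1y hd (p - 1)
  have e2 := ofReal_mul_div_cpow hv1 hvy hd (q - 1)
  have e3 : (1 - v) * (1 + y * v) / (1 - y * v ^ 2) = 1 - v * (1 - y) / (1 - y * v ^ 2) := by
    rw [eq_sub_iff_add_eq, ← add_div, div_eq_one_iff_eq hd.ne']
    ring
  have e4 : -4 * (y : ℂ) / (1 - y) ^ 2 * ((v * (1 - y) / (1 - y * v ^ 2) : ℝ) : ℂ) ^ 2 =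
      -4 * (y * v ^ 2) / (1 - y * v ^ 2) ^ 2 := by
    push_cast
    field_simp
  have e5 : (1 - y * v ^ 2 : ℂ) ^ (-(p - 1)) * (1 - y * v ^ 2 : ℂ) ^ (-(q - 1)) =
      (1 - y * v ^ 2 : ℂ) ^ (-(p + q)) * (1 - y * v ^ 2) ^ 2 := by
    rw [← cpow_natCast (1 - y * v ^ 2 : ℂ), ← cpow_add _ _ hd', ← cpow_add _ _ hd']
    congr 1
    push_cast
    ring
  have e6 : (1 - y : ℂ) ^ (-p) * (1 - y : ℂ) ^ (p - 1) * (1 - y) = 1 := by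
    conv_lhs => rw [← cpow_add _ _ h1y']; arg 2; rw [← cpow_one (1 - y : ℂ)]
    rw [← cpow_add _ _ h1y', show -p + (p - 1) + 1 = 0 by ring, cpow_zero]
  rw [e3, ofReal_sub 1 (v * (1 - y) / _), ofReal_one] at e2
  rw [e4, e1, e2, ferrersAux_eq_quadratic _ _ hyv, real_smul,
    show μ - (μ - p - q) = p + q by ring]
  push_cast
  have e7 : (1 - y * v ^ 2 : ℂ) ^ (-(p - 1)) * (1 - y * v ^ 2 : ℂ) ^ (-(q - 1)) /
      (1 - y * v ^ 2) ^ 2 = (1 - y * v ^ 2 : ℂ) ^ (-(p + q)) := by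
    rw [e5, mul_div_cancel_right₀ _ (pow_ne_zero 2 hd')]
  rw [← e7]
  generalize regularizedGaussHGFun _ _ _ _ = R
  linear_combination (v : ℂ) ^ (p - 1) * (1 - v : ℂ) ^ (q - 1) * (1 + y * v : ℂ) ^ (q - 1) *
    (1 + y * v ^ 2) * ((1 - y * v ^ 2 : ℂ) ^ (-(p - 1)) * (1 - y * v ^ 2 : ℂ) ^ (-(q - 1)) /
      (1 - y * v ^ 2) ^ 2) * R * e6

lemma differentiableOn_setIntegral_mul {U : Set ℂ} (hU : IsOpen U) {w : ℝ → ℂ}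
    (hw : IntegrableOn w (Ioo 0 1)) {G : ℂ → ℝ → ℂ}
    (hG : ContinuousOn (Function.uncurry G) (U ×ˢ Icc 0 1))
    (hd : ∀ v ∈ Icc (0 : ℝ) 1, DifferentiableOn ℂ (fun y => G y v) U) :
    DifferentiableOn ℂ (fun y => ∫ v in Ioo (0 : ℝ) 1, w v * G y v) U := by
  intro y hy
  obtain ⟨r, hr, hrU⟩ := Metric.nhds_basis_closedBall.mem_iff.mp (hU.mem_nhds hy)
  obtain ⟨C, hC⟩ := ((isCompact_closedBall y r).prod (isCompact_Icc (a := (0 : ℝ)) (b := 1)))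
    |>.exists_bound_of_continuousOn (hG.mono (prod_mono hrU subset_rfl))
  have hC' : ∀ z ∈ Metric.closedBall y r, ∀ v ∈ Icc (0 : ℝ) 1, ‖G z v‖ ≤ C := fun z hz v hv =>
    hC (z, v) ⟨hz, hv⟩
  have hGc : ∀ z ∈ U, ContinuousOn (G z) (Icc 0 1) := fun z hz =>
    hG.comp (f := fun v : ℝ => (z, v)) (by fun_prop) fun v hv => ⟨hz, hv⟩
  have hmeas : ∀ z ∈ U, AEStronglyMeasurable (fun v => w v * G z v)
      (volume.restrict (Ioo 0 1)) := fun z hz =>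
    hw.aestronglyMeasurable.mul
      (((hGc z hz).mono Ioo_subset_Icc_self).aestronglyMeasurable measurableSet_Ioo)
  have hderiv : ∀ v ∈ Icc (0 : ℝ) 1, ∀ z ∈ U,
      HasDerivAt (fun y => w v * G y v) (w v * deriv (fun y => G y v) z) z := fun v hv z hz =>
    (((hd v hv).differentiableAt (hU.mem_nhds hz)).hasDerivAt).const_mul _
  have hball : Metric.closedBall y (r / 2) ⊆ U := fun z hz =>
    hrU (Metric.closedBall_subset_closedBall (by linarith) hz)
  refine (hasDerivAt_integral_of_dominated_loc_of_deriv_le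
    (F' := fun z v => w v * deriv (fun y => G y v) z) (bound := fun v => ‖w v‖ * (C / (r / 2)))
    (Metric.closedBall_mem_nhds y (half_pos hr)) ?_ ?_ ?_ ?_ ?_
    ?_).2.differentiableAt.differentiableWithinAt
  · filter_upwards [hU.mem_nhds hy] with z hz using hmeas z hz
  · refine Integrable.mono' (hw.norm.mul_const C) (hmeas y hy) ?_
    filter_upwards [ae_restrict_mem measurableSet_Ioo] with v hv
    rw [norm_mul]
    gcongr
    exact hC' y (Metric.mem_closedBall_self hr.le) v (Ioo_subset_Icc_self hv)
  · classical
    refine aestronglyMeasurable_of_tendsto_ae (𝓝[≠] y)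
      (f := fun z v => if z ∈ U then (z - y)⁻¹ * (w v * G z v - w v * G y v) else 0)
      (fun z => ?_) ?_
    · by_cases hz : z ∈ U
      · simp only [hz, if_true]
        exact ((hmeas z hz).sub (hmeas y hy)).const_mul _
      · simpa only [hz, if_false] using aestronglyMeasurable_const
    · filter_upwards [ae_restrict_mem measurableSet_Ioo] with v hv
      refine ((hderiv v (Ioo_subset_Icc_self hv) y hy).tendsto_slope).congr' ?_
      filter_upwards [nhdsWithin_le_nhds (hU.mem_nhds hy)] with z hz
      simp [hz, slope_def_field, div_eq_inv_mul]
  · filter_upwards [ae_restrict_mem measurableSet_Ioo] with v hv z hz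
    have hv' := Ioo_subset_Icc_self hv
    rw [norm_mul]
    gcongr
    have hsub : Metric.closedBall z (r / 2) ⊆ Metric.closedBall y r := by
      refine Metric.closedBall_subset_closedBall' ?_
      rw [Metric.mem_closedBall] at hz
      linarith
    refine norm_deriv_le_of_forall_mem_sphere_norm_le (half_pos hr) ?_ fun z' hz' =>
      hC' z' (hsub (Metric.sphere_subset_closedBall hz')) v hv'
    exact ((hd v hv').mono (hsub.trans hrU)).diffContOnCl_ball subset_rfl
  · exact hw.norm.mul_const _
  · filter_upwards [ae_restrict_mem measurableSet_Ioo] with v hv z hz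
    exact hderiv v (Ioo_subset_Icc_self hv) z (hball hz)

lemma norm_div_one_add_lt_one {z : ℂ} (hz : -1 / 2 < z.re) : ‖z / (1 + z)‖ < 1 := by
  have h1 : 1 + z ≠ 0 := fun h => by
    have := congrArg re h
    simp at this
    linarith
  rw [norm_div, div_lt_one (norm_pos_iff.mpr h1), ← sq_lt_sq₀ (norm_nonneg _) (norm_nonneg _),
    ← normSq_eq_norm_sq, ← normSq_eq_norm_sq, normSq_apply, normSq_apply]
  simp
  nlinarith

lemma isOpen_neg_half_lt_re : IsOpen {z : ℂ | -1 / 2 < z.re} :=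
  isOpen_lt continuous_const continuous_re

lemma differentiableOn_ferrersAux (ν μ : ℂ) :
    DifferentiableOn ℂ (ferrersAux ν μ) {z : ℂ | -1 / 2 < z.re} := by
  intro z hz
  have hz1 : 1 + z ∈ slitPlane := by
    rw [mem_ofPred_eq] at hz
    left
    simp
    linarith
  have hF : DifferentiableAt ℂ (regularizedGaussHGFun (-ν) (ν + 1) (1 + μ)) (z / (1 + z)) := by
    refine ((hasFPowerSeriesOnBall_regularizedGaussHGFun _ _ _).differentiableOn
      (z / (1 + z)) ?_).differentiableAt (Metric.isOpen_eball.mem_nhds ?_) <;>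
    simpa [← ofReal_norm] using norm_div_one_add_lt_one hz
  have h1 : DifferentiableAt ℂ (fun y : ℂ => (1 + y) ^ ν) z :=
    (differentiableAt_id.const_add 1).cpow_const hz1
  have h2 : DifferentiableAt ℂ (fun y : ℂ => y / (1 + y)) z :=
    differentiableAt_id.div (differentiableAt_id.const_add 1) (slitPlane_ne_zero hz1)
  exact (h1.mul (hF.comp z h2)).differentiableWithinAt

lemma ferrersAux_eq_integral {p q : ℂ} (hp : 0 < p.re) (hq : 0 < q.re) (μ : ℂ) {y : ℝ}
    (hy : 0 < y) :
    Gamma q * Gamma p * ferrersAux (μ - p) μ y =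
      Gamma (p + q) * ∫ v in Ioo (0 : ℝ) 1, (v : ℂ) ^ (p - 1) * (1 - (v : ℂ)) ^ (q - 1) *
        ((1 + y * v) ^ (q - 1) * (1 + y * v ^ 2) * ferrersAux (μ - p - q) μ (y * v ^ 2)) := by
  have hmem : ∀ z : ℂ, -1 / 2 < z.re → ∀ t ∈ Icc (0 : ℝ) 1, -1 / 2 < (z * t).re := by
    intro z hz t ht
    rw [re_mul_ofReal]
    rcases ht.1.eq_or_lt with h | h
    · rw [← h]
      norm_num
    · nlinarith [ht.2, mul_pos (show 0 < z.re + 1 / 2 by linarith) h]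
  have hsq : ∀ t ∈ Icc (0 : ℝ) 1, t ^ 2 ∈ Icc (0 : ℝ) 1 := fun t ht =>
    ⟨sq_nonneg t, pow_le_one₀ ht.1 ht.2⟩
  have hslit : ∀ z : ℂ, -1 / 2 < z.re → 1 + z ∈ slitPlane := fun z hz => by
    left
    simp
    linarith
  have hψ := differentiableOn_ferrersAux (μ - p - q) μ
  let G : ℂ → ℝ → ℂ := fun y v =>
    (1 + y * v) ^ (q - 1) * (1 + y * v ^ 2) * ferrersAux (μ - p - q) μ (y * v ^ 2)
  have hGc : ContinuousOn (Function.uncurry G) ({z : ℂ | -1 / 2 < z.re} ×ˢ Icc 0 1) := by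
    refine ContinuousOn.mul (ContinuousOn.mul (ContinuousOn.cpow_const ?_ ?_) ?_)
      (hψ.continuousOn.comp (f := fun x : ℂ × ℝ => x.1 * (x.2 : ℂ) ^ 2) ?_ ?_)
    · fun_prop
    · exact fun x hx => hslit _ (hmem _ hx.1 _ hx.2)
    · fun_prop
    · fun_prop
    · intro x hx
      simpa using hmem _ hx.1 _ (hsq _ hx.2)
  have hGd : ∀ v ∈ Icc (0 : ℝ) 1,
      DifferentiableOn ℂ (fun y => G y v) {z : ℂ | -1 / 2 < z.re} := by
    intro v hv
    refine DifferentiableOn.mul (DifferentiableOn.mul (DifferentiableOn.cpow_const ?_ ?_) ?_)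
      (hψ.comp (f := fun x : ℂ => x * (v : ℂ) ^ 2) ?_ ?_)
    · fun_prop
    · exact fun z hz => hslit _ (hmem _ hz _ hv)
    · fun_prop
    · fun_prop
    · intro z hz
      simpa using hmem _ hz _ (hsq _ hv)
  have hR := (differentiableOn_setIntegral_mul isOpen_neg_half_lt_re (integrableOn_beta hp hq)
    hGc hGd).const_mul (Gamma (p + q))
  have hL := (differentiableOn_ferrersAux (μ - p) μ).const_mul (Gamma q * Gamma p)
  have hconv : Convex ℝ {z : ℂ | -1 / 2 < z.re} := convex_halfSpace_re_gt _
  refine (hL.analyticOnNhd isOpen_neg_half_lt_re).eqOn_of_preconnected_of_frequently_eq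
    (hR.analyticOnNhd isOpen_neg_half_lt_re) hconv.isPreconnected (z₀ := 0)
    (show (-1 / 2 : ℝ) < (0 : ℂ).re by norm_num) ?_
    (show (y : ℂ) ∈ {z : ℂ | -1 / 2 < z.re} by simp; linarith)
  have hlim : Tendsto (fun t : ℝ => (t : ℂ)) (𝓝[>] 0) (𝓝[≠] 0) := by
    refine tendsto_nhdsWithin_iff.mpr ⟨?_, ?_⟩
    · exact (continuous_ofReal.tendsto' 0 0 ofReal_zero).mono_left nhdsWithin_le_nhds
    · filter_upwards [self_mem_nhdsWithin] with t ht
      simpa using (ne_of_gt ht)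
  refine hlim.frequently (Eventually.frequently ?_)
  filter_upwards [Ioo_mem_nhdsGT (show (0 : ℝ) < 1 / 10 by norm_num)] with t ht
  exact ferrersAux_eq_integral_of_lt hp hq μ ht.1 ht.2

lemma ferrersP_neg_mul_cosh_cpow (ν μ : ℂ) (s : ℝ) :
    ferrersP ν (-μ) (Real.tanh s) * ((Real.cosh s : ℝ) : ℂ) ^ ν =
      2 ^ (-ν) * (Real.exp (-s) : ℂ) ^ (μ - ν) * ferrersAux ν μ ((Real.exp (-s) : ℂ) ^ 2) := by
  have hes : Real.exp s = (Real.exp (-s))⁻¹ := by rw [Real.exp_neg, inv_inv]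
  have hE : 0 < Real.exp (-s) := Real.exp_pos _
  have hcosh : Real.cosh s = (1 + Real.exp (-s) ^ 2) * (Real.exp (-s))⁻¹ / 2 := by
    rw [Real.cosh_eq, hes]
    field_simp
  have hsinh : Real.sinh s = (1 - Real.exp (-s) ^ 2) * (Real.exp (-s))⁻¹ / 2 := by
    rw [Real.sinh_eq, hes]
    field_simp
  have htanh : Real.tanh s = (1 - Real.exp (-s) ^ 2) / (1 + Real.exp (-s) ^ 2) := by
    rw [Real.tanh_eq_sinh_div_cosh, hcosh, hsinh]
    field_simp
  set E := Real.exp (-s)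
  have hE2 : 0 < 1 + E ^ 2 := by positivity
  have hEc : (E : ℂ) ≠ 0 := by exact_mod_cast hE.ne'
  have e1 : (1 + Real.tanh s) / (1 - Real.tanh s) = (E * E)⁻¹ := by
    rw [htanh]
    field_simp
    ring
  have e2 : (1 - Real.tanh s) / 2 = E ^ 2 / (1 + E ^ 2) := by
    rw [htanh]
    field_simp
    ring
  have e3 : (((E * E)⁻¹ : ℝ) : ℂ) ^ (-μ / 2) = (E : ℂ) ^ μ := by
    rw [ofReal_inv,
      inv_cpow _ _ (by rw [arg_ofReal_of_nonneg (by positivity)]; exact Real.pi_pos.ne), ← cpow_neg, ofReal_mul, mul_cpow_ofReal_nonneg hE.le hE.le, ← cpow_add _ _ hEc]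
    congr 1
    ring
  have hz : ‖(E : ℂ) ^ 2 / (1 + (E : ℂ) ^ 2)‖ < 1 := by
    refine norm_div_one_add_lt_one ?_
    rw [← ofReal_pow, ofReal_re]
    nlinarith
  rw [ferrersP, e1, e2, e3, hcosh, ofReal_mul_div_cpow hE2 (inv_pos.mpr hE) two_pos, ferrersAux,
    ← (hasSum_regularizedGaussHGFun (-ν) (ν + 1) (1 + μ) hz).tsum_eq, sub_eq_add_neg μ ν,
    cpow_add _ _ hEc, ofReal_inv E, inv_cpow _ _ (by
      rw [arg_ofReal_of_nonneg hE.le]; exact Real.pi_pos.ne), ← cpow_neg]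
  have e4 : ∀ n : ℕ, pochC (-ν) n * pochC (ν + 1) n /
        (Complex.Gamma ((n : ℂ) + 1 - -μ) * (n.factorial : ℂ)) *
      ((E ^ 2 / (1 + E ^ 2) : ℝ) : ℂ) ^ n =
      (regularizedGaussHGFunSeries (-ν) (ν + 1) (1 + μ)).coeff n *
        ((E : ℂ) ^ 2 / (1 + (E : ℂ) ^ 2)) ^ n := fun n => by
    rw [coeff_regularizedGaussHGFunSeries_eq_pochC, sub_neg_eq_add,
      show (n : ℂ) + 1 + μ = 1 + μ + n by ring, mul_comm (Gamma _)]
    push_cast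
    rfl
  rw [tsum_congr e4]
  push_cast
  ring

lemma setIntegral_Ioi_comp_sub_log (α : ℝ) (f : ℝ → ℂ) :
    ∫ s in Ioi α, f s = ∫ v in Ioo (0 : ℝ) 1, v⁻¹ • f (α - Real.log v) := by
  have himage : (fun v => α - Real.log v) '' Ioo 0 1 = Ioi α := by
    refine Subset.antisymm ?_ fun s hs => ?_
    · rintro _ ⟨v, hv, rfl⟩
      have := Real.log_neg hv.1 hv.2
      simp only [mem_Ioi]
      linarith
    · refine ⟨Real.exp (α - s), ⟨Real.exp_pos _, ?_⟩, ?_⟩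
      · rw [Real.exp_lt_one_iff]
        exact sub_neg.mpr hs
      · simp
  have hinj : InjOn (fun v => α - Real.log v) (Ioo 0 1) := fun v hv w hw h =>
    Real.log_injOn_pos hv.1 hw.1 (sub_right_injective h)
  conv_lhs => rw [← himage]
  rw [integral_image_eq_integral_abs_deriv_smul measurableSet_Ioo
    (fun v hv => ((Real.hasDerivAt_log hv.1.ne').const_sub α).hasDerivWithinAt) hinj]
  refine setIntegral_congr_fun measurableSet_Ioo fun v hv => ?_
  have := hv.1
  rw [abs_neg, abs_of_pos (by positivity)]

theorem stmt4 (α : ℝ) (μ ρ lam : ℂ) (h1 : lam.re + 1 < (μ - ρ).re) (h2 : 0 < lam.re + 1) :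
    ferrersP (lam + ρ + 1) (-μ) (Real.tanh α) * ((Real.cosh α : ℝ) : ℂ) ^ (lam + ρ + 1) =
      Complex.Gamma (μ - ρ) / (Complex.Gamma (1 + lam) * Complex.Gamma (μ - lam - ρ - 1)) *
        ∫ s in Set.Ioi α,
          ferrersP ρ (-μ) (Real.tanh s) * ((Real.cosh s : ℝ) : ℂ) ^ (ρ + 1) *
            ((Real.sinh s - Real.sinh α : ℝ) : ℂ) ^ lam := by
  have hp : 0 < (μ - lam - ρ - 1).re := by
    simp only [sub_re, one_re] at h1 ⊢
    linarith
  have hq : 0 < (1 + lam).re := by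
    simp only [add_re, one_re]
    linarith
  set p := μ - lam - ρ - 1 with hpdef
  set Q := Real.exp (-α) with hQdef
  have hQ : 0 < Q := Real.exp_pos _
  have hQc : (Q : ℂ) ≠ 0 := by exact_mod_cast hQ.ne'
  have hM := ferrersAux_eq_integral hp hq μ (y := Q ^ 2) (by positivity)
  rw [show μ - p = lam + ρ + 1 by rw [hpdef]; ring, show p + (1 + lam) = μ - ρ by rw [hpdef]; ring,
    show lam + ρ + 1 - (1 + lam) = ρ by ring, add_sub_cancel_left] at hM
  have hint : ∫ s in Set.Ioi α, ferrersP ρ (-μ) (Real.tanh s) *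
        ((Real.cosh s : ℝ) : ℂ) ^ (ρ + 1) * ((Real.sinh s - Real.sinh α : ℝ) : ℂ) ^ lam =
      2 ^ (-(lam + ρ + 1)) * (Q : ℂ) ^ p *
        ∫ v in Ioo (0 : ℝ) 1, (v : ℂ) ^ (p - 1) * (1 - (v : ℂ)) ^ lam *
          ((1 + ((Q ^ 2 : ℝ) : ℂ) * v) ^ lam * (1 + ((Q ^ 2 : ℝ) : ℂ) * v ^ 2) *
            ferrersAux ρ μ (((Q ^ 2 : ℝ) : ℂ) * v ^ 2)) := by
    rw [setIntegral_Ioi_comp_sub_log, ← integral_const_mul]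
    refine setIntegral_congr_fun measurableSet_Ioo fun v hv => ?_
    have hv0 := hv.1
    have hvc : (v : ℂ) ≠ 0 := by exact_mod_cast hv0.ne'
    have hv1 : 0 < 1 - v := by linarith [hv.2]
    have hexp : Real.exp (-(α - Real.log v)) = Q * v := by
      rw [neg_sub, sub_eq_neg_add, Real.exp_add, Real.exp_log hv0]
    have hexp' : Real.exp (α - Real.log v) = (Q * v)⁻¹ := by
      rw [← hexp, Real.exp_neg, inv_inv]
    have hcosh : Real.cosh (α - Real.log v) = (1 + Q ^ 2 * v ^ 2) / (2 * (Q * v)) := by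
      rw [Real.cosh_eq, hexp, hexp']
      field_simp
    have hcoshc : ((Real.cosh (α - Real.log v) : ℝ) : ℂ) ≠ 0 := by
      exact_mod_cast (Real.cosh_pos _).ne'
    have hsinh : Real.sinh (α - Real.log v) - Real.sinh α =
        (1 - v) * (1 + Q ^ 2 * v) / (2 * (Q * v)) := by
      rw [Real.sinh_eq, Real.sinh_eq, hexp, hexp', show Real.exp α = Q⁻¹ by
        rw [hQdef, Real.exp_neg, inv_inv], ← hQdef]
      field_simp
      ring
    have hP := ferrersP_neg_mul_cosh_cpow ρ μ (α - Real.log v)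
    rw [hexp] at hP
    rw [cpow_add _ _ hcoshc, cpow_one, ← mul_assoc, hP, hsinh,
      ofReal_mul_div_cpow hv1 (by positivity) (by positivity), hcosh, real_smul,
      ofReal_mul 2, ofReal_mul Q, mul_cpow_ofReal_nonneg hQ.le hv0.le, ← ofReal_mul Q,
      mul_cpow_ofReal_nonneg zero_le_two (by positivity), ofReal_mul Q,
      mul_cpow_ofReal_nonneg hQ.le hv0.le]
    have f1 : (v : ℂ) ^ (p - 1) * v ^ 2 = (v : ℂ) ^ (μ - ρ) * (v : ℂ) ^ (-lam) := by
      rw [← cpow_natCast, ← cpow_add _ _ hvc, ← cpow_add _ _ hvc]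
      congr 1
      rw [hpdef]
      push_cast
      ring
    have f2 : (Q : ℂ) ^ p * Q = (Q : ℂ) ^ (μ - ρ) * (Q : ℂ) ^ (-lam) := by
      conv_lhs => arg 2; rw [← cpow_one (Q : ℂ)]
      rw [← cpow_add _ _ hQc, ← cpow_add _ _ hQc]
      congr 1
      rw [hpdef]
      ring
    have f3 : (2 : ℂ) ^ (-(lam + ρ + 1)) * 2 = 2 ^ (-ρ) * 2 ^ (-lam) := by
      conv_lhs => arg 2; rw [← cpow_one (2 : ℂ)]
      rw [← cpow_add _ _ two_ne_zero, ← cpow_add _ _ two_ne_zero]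
      congr 1
      ring
    push_cast
    rw [mul_pow]
    trans ((2 : ℂ) ^ (-ρ) * 2 ^ (-lam)) * ((Q : ℂ) ^ (μ - ρ) * (Q : ℂ) ^ (-lam)) *
      ((v : ℂ) ^ (μ - ρ) * (v : ℂ) ^ (-lam)) / (2 * Q * v ^ 2) * (1 - v) ^ lam *
      (1 + Q ^ 2 * v) ^ lam * (1 + Q ^ 2 * v ^ 2) * ferrersAux ρ μ (Q ^ 2 * v ^ 2)
    · generalize ferrersAux ρ μ (Q ^ 2 * v ^ 2) = R, (1 - v : ℂ) ^ lam = A,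
        (1 + Q ^ 2 * v : ℂ) ^ lam = B, (2 : ℂ) ^ (-ρ) = a, (2 : ℂ) ^ (-lam) = b,
        (Q : ℂ) ^ (μ - ρ) = c, (Q : ℂ) ^ (-lam) = d, (v : ℂ) ^ (μ - ρ) = e, (v : ℂ) ^ (-lam) = f
      field_simp
    · rw [← f1, ← f2, ← f3]
      generalize ferrersAux ρ μ (Q ^ 2 * v ^ 2) = R, (1 - v : ℂ) ^ lam = A,
        (1 + Q ^ 2 * v : ℂ) ^ lam = B, (2 : ℂ) ^ (-(lam + ρ + 1)) = a, (Q : ℂ) ^ p = b,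
        (v : ℂ) ^ (p - 1) = c
      field_simp
  rw [hint, ferrersP_neg_mul_cosh_cpow, show μ - (lam + ρ + 1) = p by rw [hpdef]; ring, ← hQdef,
    ← ofReal_pow]
  have hg1 := Gamma_ne_zero_of_re_pos hp
  have hg2 := Gamma_ne_zero_of_re_pos hq
  rw [mul_left_comm, div_mul_eq_mul_div, ← hM, mul_div_cancel_left₀ _ (mul_ne_zero hg2 hg1)]
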